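/- (Theorem 1, inequality) Let n be an even positive integer and V a real n×n circulant symmetric positive definite matrix. Then the logarithmic negativity of the symmetrically bisected chain satisfies N(V) ≥ |Tr(F_n · log₂ V)| / 2, where log₂ V = (log V)/ln 2. -/

import Mathlib

open Matrix Polynomial

/-- The `m × m` flip matrix `F_m`: with 0-based indices, entry `(i,j)` is `1`
iff `i + j = m - 1`. -/
noncomputable def flipMat (m : ℕ) : Matrix (Fin m) (Fin m) ℝ :=
  Matrix.of fun i j => if (i : ℕ) + (j : ℕ) = m - 1 then 1 else 0

/-- Real matrix power `M ^ p` defined via the continuous functional calculus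
(spectral calculus). -/
noncomputable def mpow {k : ℕ} (M : Matrix (Fin k) (Fin k) ℝ) (p : ℝ) :
    Matrix (Fin k) (Fin k) ℝ :=
  cfc (fun x : ℝ => x ^ p) M

/-- Matrix base-2 logarithm `log₂ M = (log M)/ln 2` defined via the continuous
functional calculus (spectral calculus). -/
noncomputable def mlogb2 {k : ℕ} (M : Matrix (Fin k) (Fin k) ℝ) :
    Matrix (Fin k) (Fin k) ℝ :=
  cfc (fun x : ℝ => Real.logb 2 x) M

section aux
variable {ι : Type*} [Fintype ι] [DecidableEq ι]

lemma aux_aeval (E L : Matrix ι ι ℝ) (hE : E * E = E) (hc : Commute E L) (p : ℝ[X]) :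
    aeval (E * L) p = E * aeval L p + p.eval 0 • (1 - E) := by
  induction p using Polynomial.induction_on' with
  | add p q hp hq =>
    rw [map_add, map_add, hp, hq, eval_add]
    simp only [mul_add, add_smul]; abel
  | monomial k a =>
    rw [aeval_monomial, aeval_monomial, eval_monomial]
    rcases k with _ | k
    · simp [Algebra.algebraMap_eq_smul_one, smul_sub]
    · have hE' : IsIdempotentElem E := hE
      rw [hc.mul_pow, hE'.pow_succ_eq]
      simp [Algebra.algebraMap_eq_smul_one]

lemma aux_interp (s : Set ℝ) (hs : s.Finite) (f : ℝ → ℝ) :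
    ∃ p : ℝ[X], ∀ x ∈ s, p.eval x = f x := by
  refine ⟨Lagrange.interpolate hs.toFinset id f, fun x hx => ?_⟩
  exact Lagrange.eval_interpolate_at_node (v := id) f (Set.injOn_id _) (by simpa using hx)

lemma aux_cfc_poly (A : Matrix ι ι ℝ) (hA : A.IsHermitian) (f : ℝ → ℝ) (p : ℝ[X])
    (h : ∀ x ∈ spectrum ℝ A, p.eval x = f x) : cfc f A = aeval A p := by
  rw [← cfc_polynomial p A hA]
  exact cfc_congr fun x hx => (h x hx).symm

lemma aux_cfc_commute (A B : Matrix ι ι ℝ) (hA : A.IsHermitian) (f : ℝ → ℝ)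
    (h : Commute B A) : Commute B (cfc f A) := by
  obtain ⟨p, hp⟩ := aux_interp _ A.finite_real_spectrum f
  rw [aux_cfc_poly A hA f p hp, aeval_eq_sum_range]
  exact Commute.sum_right _ _ _ fun i _ => (h.pow_right i).smul_right _

lemma aux_cont (A : Matrix ι ι ℝ) (f : ℝ → ℝ) : ContinuousOn f (spectrum ℝ A) :=
  A.finite_real_spectrum.continuousOn f

lemma aux_det_cfc (A : Matrix ι ι ℝ) (hA : A.IsHermitian) (f : ℝ → ℝ) :
    (cfc f A).det = ∏ i, f (hA.eigenvalues i) := by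
  rw [hA.cfc_eq f, IsHermitian.cfc, Unitary.conjStarAlgAut_apply, Matrix.det_mul_comm, ← mul_assoc]
  simp

lemma aux_spec_pos (A : Matrix ι ι ℝ) (hA : A.PosDef) : ∀ x ∈ spectrum ℝ A, 0 < x := by
  intro x hx
  rw [hA.1.spectrum_real_eq_range_eigenvalues] at hx
  obtain ⟨i, rfl⟩ := hx
  exact hA.eigenvalues_pos i

lemma aux_cfc_mul (A : Matrix ι ι ℝ) (f g : ℝ → ℝ) :
    cfc f A * cfc g A = cfc (fun x => f x * g x) A :=
  (cfc_mul f g A (aux_cont A f) (aux_cont A g)).symm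

lemma aux_cfc_herm (A : Matrix ι ι ℝ) (f : ℝ → ℝ) : (cfc f A).IsHermitian :=
  cfc_predicate f A

noncomputable def auxdl (E X : Matrix ι ι ℝ) : ℝ := (E * X + (1 - E)).det

lemma aux_key (E X : Matrix ι ι ℝ) (hE : E * E = E) (hEh : E.IsHermitian)
    (hc : Commute E X) (hX : X.PosDef) :
    auxdl E X = (2 : ℝ) ^ (E * cfc (fun x : ℝ => Real.logb 2 x) X).trace := by
  set L := cfc (fun x : ℝ => Real.logb 2 x) X with hL
  have hLh : L.IsHermitian := aux_cfc_herm _ _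
  have hcL : Commute E L := aux_cfc_commute _ _ hX.1 _ hc
  have hELh : (E * L).IsHermitian := by
    rw [IsHermitian, conjTranspose_mul, hLh.eq, hEh.eq, hcL.eq]
  obtain ⟨p, hp⟩ := aux_interp (spectrum ℝ (E * L) ∪ spectrum ℝ L ∪ {0})
    (((E * L).finite_real_spectrum.union L.finite_real_spectrum).union (Set.finite_singleton 0))
    (fun x : ℝ => (2 : ℝ) ^ x)
  have h1 := aux_cfc_poly (E * L) hELh (fun x : ℝ => (2 : ℝ) ^ x) p (fun x hx => hp x (by simp [hx]))
  have h2 := aux_cfc_poly L hLh (fun x : ℝ => (2 : ℝ) ^ x) p (fun x hx => hp x (by simp [hx]))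
  have h3 : cfc (fun x : ℝ => (2 : ℝ) ^ x) L = X := by
    refine (cfc_comp' (fun x : ℝ => (2 : ℝ) ^ x) (fun x : ℝ => Real.logb 2 x) X
      ((X.finite_real_spectrum.image _).continuousOn _) (aux_cont _ _) hX.1).symm.trans ?_
    conv_rhs => rw [← cfc_id' ℝ X hX.1]
    refine cfc_congr fun x hx => ?_
    exact Real.rpow_logb (by norm_num) (by norm_num) (aux_spec_pos X hX x hx)
  have h4 := hp 0 (by simp)
  have h5 := aux_aeval E L hE hcL p
  rw [h4, ← h2, h3, ← h1] at h5
  simp only [Real.rpow_zero, one_smul] at h5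
  rw [auxdl, ← h5, aux_det_cfc _ hELh, hELh.trace_eq_sum_eigenvalues,
    Real.rpow_sum_of_pos (by norm_num)]
  simp

lemma auxdl_mul (E X Y : Matrix ι ι ℝ) (hE : E * E = E) (hc : Commute E X) :
    auxdl E (X * Y) = auxdl E X * auxdl E Y := by
  rw [auxdl, auxdl, auxdl, ← det_mul]
  congr 1
  have h : E * X * E = E * X := by rw [mul_assoc, ← hc.eq, ← mul_assoc, hE]
  have h1 : E * X * (E * Y) = E * (X * Y) := by rw [← mul_assoc, h, mul_assoc]
  have h2 : E * (E * Y) = E * Y := by rw [← mul_assoc, hE]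
  simp only [add_mul, mul_add, sub_mul, mul_sub, one_mul, mul_one, h, h1, h2, hE]
  abel

lemma auxdl_one (E : Matrix ι ι ℝ) : auxdl E 1 = 1 := by
  simp [auxdl]

lemma auxdl_conj (E X P : Matrix ι ι ℝ) (hP : P * P = 1) (hPE : E * P = P * (1 - E)) :
    auxdl E (P * X * P) = auxdl (1 - E) X := by
  have h : E * (P * X * P) + (1 - E) = P * ((1 - E) * X + (1 - (1 - E))) * P := by
    have h2 : P * E * P = 1 - E := by
      have : P * E = P - E * P := by rw [hPE]; simp [mul_sub]
      rw [this, sub_mul, mul_assoc, hP]; simp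
    calc _ = (E * P) * X * P + (1 - E) := by simp only [mul_assoc]
      _ = P * (1 - E) * X * P + P * E * P := by rw [hPE, h2]
      _ = _ := by simp only [mul_assoc, mul_add, add_mul, sub_sub_cancel]
  have hd : P.det * P.det = 1 := by rw [← det_mul, hP, det_one]
  rw [auxdl, auxdl, h, det_mul, det_mul, mul_right_comm, hd, one_mul]

lemma aux_trace_le (F K : Matrix ι ι ℝ) (hF : F ∈ unitaryGroup ι ℝ) (hK : K.IsHermitian)
    (f : ℝ → ℝ) :
    |(F * cfc f K).trace| ≤ ∑ i, |f (hK.eigenvalues i)| := by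
  rw [hK.cfc_eq f, IsHermitian.cfc, Unitary.conjStarAlgAut_apply]
  set U := hK.eigenvectorUnitary
  have h1 : (F * ((U : Matrix ι ι ℝ) * diagonal (RCLike.ofReal ∘ f ∘ hK.eigenvalues) *
      (star U : Matrix ι ι ℝ))).trace =
      ∑ i, ((star U : Matrix ι ι ℝ) * F * (U : Matrix ι ι ℝ)) i i * f (hK.eigenvalues i) := by
    rw [← mul_assoc, Matrix.trace_mul_comm, ← mul_assoc, ← mul_assoc, trace]
    simp [mul_diagonal]
  have hU : (star U : Matrix ι ι ℝ) * F * (U : Matrix ι ι ℝ) ∈ unitaryGroup ι ℝ :=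
    mul_mem (mul_mem (star U).2 hF) U.2
  rw [h1]
  refine (Finset.abs_sum_le_sum_abs _ _).trans (Finset.sum_le_sum fun i _ => ?_)
  rw [abs_mul]
  have := entry_norm_bound_of_unitary hU i i
  rw [Real.norm_eq_abs] at this
  exact mul_le_of_le_one_left (abs_nonneg _) this
end aux

lemma aux_flip_apply (n : ℕ) (i j : Fin n) : flipMat n i j = if j = i.rev then 1 else 0 := by
  simp only [flipMat, of_apply, Fin.ext_iff, Fin.val_rev]
  congr 1
  apply propext
  omega

lemma aux_flip_mul (n : ℕ) (M : Matrix (Fin n) (Fin n) ℝ) (i j : Fin n) :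
    (flipMat n * M) i j = M i.rev j := by
  simp [Matrix.mul_apply, aux_flip_apply]

lemma aux_mul_flip (n : ℕ) (M : Matrix (Fin n) (Fin n) ℝ) (i j : Fin n) :
    (M * flipMat n) i j = M i j.rev := by
  have : ∀ k : Fin n, (j = k.rev) = (k = j.rev) := fun k => by
    exact propext ⟨fun h => by rw [h, Fin.rev_rev], fun h => by rw [h, Fin.rev_rev]⟩
  simp [Matrix.mul_apply, aux_flip_apply, this]

lemma aux_flip_sq (n : ℕ) : flipMat n * flipMat n = 1 := by
  ext i j
  rw [aux_flip_mul, aux_flip_apply, Fin.rev_rev, Matrix.one_apply]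
  simp [eq_comm]

lemma aux_flip_herm (n : ℕ) : (flipMat n).IsHermitian := by
  ext i j
  simp only [conjTranspose_apply, aux_flip_apply]
  have : (i = j.rev) = (j = i.rev) := by exact propext ⟨fun h => by rw [h, Fin.rev_rev], fun h => by rw [h, Fin.rev_rev]⟩
  simp [this]

lemma aux_flip_unitary (n : ℕ) : flipMat n ∈ unitaryGroup (Fin n) ℝ := by
  rw [mem_unitaryGroup_iff, star_eq_conjTranspose, (aux_flip_herm n).eq, aux_flip_sq]

lemma aux_flip_circ (n : ℕ) (v : Fin n → ℝ) (hv : ∀ l, v (-l) = v l) :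
    Commute (flipMat n) (circulant v) := by
  rcases n with _ | n
  · exact Subsingleton.elim _ _
  ext i j
  rw [aux_flip_mul, aux_mul_flip, circulant_apply, circulant_apply, ← hv]
  congr 1
  rw [← Fin.last_sub, ← Fin.last_sub]
  abel

lemma aux_flip_P (m : ℕ) (P : Matrix (Fin (m + m)) (Fin (m + m)) ℝ)
    (hP : P = Matrix.diagonal (fun i : Fin (m + m) => if (i : ℕ) < m then (1 : ℝ) else -1)) :
    flipMat (m + m) * P = - (P * flipMat (m + m)) := by
  ext i j
  rw [Matrix.neg_apply, aux_flip_mul, aux_mul_flip, hP, diagonal_apply, diagonal_apply,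
    Fin.val_rev]
  by_cases h : i.rev = j
  · have h' : i = j.rev := by rw [← h, Fin.rev_rev]
    rw [if_pos h, if_pos h']
    have := i.2
    split_ifs <;> first | omega | norm_num
  · have h' : ¬ i = j.rev := fun h' => h (by rw [h', Fin.rev_rev])
    rw [if_neg h, if_neg h', neg_zero]

lemma aux_P_sq (m : ℕ) (P : Matrix (Fin (m + m)) (Fin (m + m)) ℝ)
    (hP : P = Matrix.diagonal (fun i : Fin (m + m) => if (i : ℕ) < m then (1 : ℝ) else -1)) :
    P * P = 1 := by
  rw [hP, diagonal_mul_diagonal, ← diagonal_one]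
  congr 1
  ext i
  split_ifs <;> norm_num

lemma aux_posdef {n : ℕ} (B B' : Matrix (Fin n) (Fin n) ℝ) (h : B * B' = 1) :
    (B * Bᴴ).PosDef := by
  have h' : B' * B = 1 := mul_eq_one_comm.mp h
  have := (PosDef.one (n := Fin n) (R := ℝ)).mul_mul_conjTranspose_same (B := B) (by
    intro x y hxy
    have := congrArg (fun z => z ᵥ* B') hxy
    simpa [h] using this)
  simpa using this

lemma aux_mpow_mul {n : ℕ} (V : Matrix (Fin n) (Fin n) ℝ) (hV : V.PosDef) (a b c : ℝ)
    (h : a + b = c) : mpow V a * mpow V b = mpow V c := by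
  rw [mpow, mpow, mpow, aux_cfc_mul]
  refine cfc_congr fun x hx => ?_
  simp only [← h]
  exact (Real.rpow_add (aux_spec_pos V hV x hx) a b).symm

lemma aux_mpow_zero {n : ℕ} (V : Matrix (Fin n) (Fin n) ℝ) (hV : V.PosDef) :
    mpow V 0 = 1 := by
  rw [mpow, ← cfc_one ℝ V hV.1]
  exact cfc_congr fun x hx => by simp

lemma aux_mpow_one {n : ℕ} (V : Matrix (Fin n) (Fin n) ℝ) (hV : V.PosDef) :
    mpow V 1 = V := by
  conv_rhs => rw [← cfc_id' ℝ V hV.1]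
  rw [mpow]
  exact cfc_congr fun x hx => by simp

/-- The determinant computation on one eigenspace of the flip. -/
lemma aux_dl_rel {n : ℕ} (E V P W W' R' : Matrix (Fin n) (Fin n) ℝ) (hE : E * E = E)
    (hP : P * P = 1) (hPE : E * P = P * (1 - E)) (hW : W' * W = 1) (hWW : W * W = V)
    (hR : R' * R' = W') (cW : Commute E W) (cR : Commute E R') :
    auxdl E (R' * P * W * P * R') * auxdl E W = auxdl (1 - E) W ∧
      auxdl E V = auxdl E W * auxdl E W := by
  have cW' : Commute E W' := by rw [← hR]; exact cR.mul_right cR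
  have cPWP : Commute E (P * W * P) := by
    have h2 : P * E = (1 - E) * P := by
      rw [sub_mul, one_mul, hPE]; simp [mul_sub]
    have h3 : Commute (1 - E) W := (Commute.one_left W).sub_left cW
    have h4 : (1 - E) * P = P * E := h2.symm
    change E * (P * W * P) = P * W * P * E
    calc E * (P * W * P) = (E * P) * W * P := by simp only [mul_assoc]
      _ = P * ((1 - E) * W) * P := by rw [hPE]; simp only [mul_assoc]
      _ = P * W * ((1 - E) * P) := by rw [h3.eq]; simp only [mul_assoc]
      _ = _ := by rw [h4]; simp only [mul_assoc]
  constructor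
  · have : R' * P * W * P * R' = R' * ((P * W * P) * R') := by simp only [mul_assoc]
    rw [this, auxdl_mul _ _ _ hE cR, auxdl_mul _ _ _ hE cPWP, auxdl_conj _ _ _ hP hPE]
    have h1 : auxdl E R' * auxdl E R' * auxdl E W = 1 := by
      rw [← auxdl_mul _ _ _ hE cR, hR, ← auxdl_mul _ _ _ hE cW', hW, auxdl_one]
    linear_combination auxdl (1 - E) W * h1
  · rw [← hWW, auxdl_mul _ _ _ hE cW]

/-- **Theorem 1, inequality.** For `n = m + m` even positive and
`V` circulant symmetric positive definite, with `Q = V^{-1/2} P V^{1/2} P`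
having (real, with multiplicity) eigenvalues `λ₁, …, λₙ` (encoded by the
factorization of its characteristic polynomial), the logarithmic negativity
`N = -∑ⱼ log₂ min(1, λⱼ)` of the symmetrically bisected chain satisfies
`N ≥ |Tr(F_n log₂ V)| / 2`. -/
theorem logneg_ge_half_abs_trace_flip_log
    (m : ℕ) (hm : 0 < m)
    (v : Fin (m + m) → ℝ) (hv : ∀ l, v (-l) = v l)
    (V : Matrix (Fin (m + m)) (Fin (m + m)) ℝ) (hV : V = Matrix.circulant v)
    (hVpd : V.PosDef)
    (P : Matrix (Fin (m + m)) (Fin (m + m)) ℝ)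
    (hP : P = Matrix.diagonal (fun i : Fin (m + m) => if (i : ℕ) < m then (1 : ℝ) else -1))
    (Q : Matrix (Fin (m + m)) (Fin (m + m)) ℝ)
    (hQ : Q = mpow V (-(1/2)) * P * mpow V (1/2) * P)
    (lam : Fin (m + m) → ℝ)
    (hlam : Q.charpoly = ∏ j : Fin (m + m), (X - C (lam j)))
    (N : ℝ) (hN : N = -∑ j : Fin (m + m), Real.logb 2 (min 1 (lam j))) :
    N ≥ |(flipMat (m + m) * mlogb2 V).trace| / 2 := by
  set F := flipMat (m + m) with hF
  have hFF : F * F = 1 := aux_flip_sq _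
  have hFh : F.IsHermitian := aux_flip_herm _
  have hFV : Commute F V := by rw [hV]; exact aux_flip_circ _ v hv
  have hFP : F * P = -(P * F) := aux_flip_P m P hP
  have hPP : P * P = 1 := aux_P_sq m P hP
  have hPh : P.IsHermitian := by rw [hP]; exact isHermitian_diagonal _
  set W := mpow V (1/2) with hWdef
  set W' := mpow V (-(1/2)) with hW'def
  set R := mpow V (1/4) with hRdef
  set R' := mpow V (-(1/4)) with hR'def
  have hWW : W * W = V := by
    rw [hWdef, aux_mpow_mul V hVpd _ _ 1 (by norm_num), aux_mpow_one V hVpd]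
  have hW'W : W' * W = 1 := by
    rw [hWdef, hW'def, aux_mpow_mul V hVpd _ _ 0 (by norm_num), aux_mpow_zero V hVpd]
  have hRR : R * R = W := by
    rw [hWdef, hRdef, aux_mpow_mul V hVpd _ _ (1/2) (by norm_num)]
  have hR'R' : R' * R' = W' := by
    rw [hW'def, hR'def, aux_mpow_mul V hVpd _ _ (-(1/2)) (by norm_num)]
  have hR'R : R' * R = 1 := by
    rw [hRdef, hR'def, aux_mpow_mul V hVpd _ _ 0 (by norm_num), aux_mpow_zero V hVpd]
  have hRR' : R * R' = 1 := mul_eq_one_comm.mp hR'R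
  have hRh : R.IsHermitian := aux_cfc_herm _ _
  have hR'h : R'.IsHermitian := aux_cfc_herm _ _
  have cFW : Commute F W := aux_cfc_commute _ _ hVpd.1 _ hFV
  have cFR' : Commute F R' := aux_cfc_commute _ _ hVpd.1 _ hFV
  set K := R' * P * W * P * R' with hKdef
  have hWpd : W.PosDef := by
    have := aux_posdef R R' hRR'
    rwa [hRh.eq, hRR] at this
  have hKpd : K.PosDef := by
    have h := aux_posdef (R' * P * R) (R' * P * R) (by
      calc R' * P * R * (R' * P * R) = R' * P * (R * R') * P * R := by simp only [mul_assoc]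
        _ = R' * (P * P) * R := by rw [hRR', mul_one]; simp only [mul_assoc]
        _ = 1 := by rw [hPP, mul_one, hR'R])
    have e : R' * P * R * (R' * P * R)ᴴ = K := by
      rw [conjTranspose_mul, conjTranspose_mul, hRh.eq, hR'h.eq, hPh.eq, hKdef, ← hRR]
      simp only [mul_assoc]
    rwa [e] at h
  -- charpoly
  have hchar : K.charpoly = Q.charpoly := by
    have e : Q = R' * (R' * P * W * P) := by rw [hQ, ← hR'R']; simp only [mul_assoc]
    rw [e, Matrix.charpoly_mul_comm]
  set μ := hKpd.1.eigenvalues with hμ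
  have hms : Multiset.map lam Finset.univ.val = Multiset.map μ Finset.univ.val := by
    have h1 := hKpd.1.roots_charpoly_eq_eigenvalues
    rw [hchar, hlam, Polynomial.roots_prod _ _ (by
      simp [Finset.prod_ne_zero_iff, Polynomial.X_sub_C_ne_zero])] at h1
    simpa using h1
  have hsum : ∀ f : ℝ → ℝ, ∑ j, f (lam j) = ∑ j, f (μ j) := by
    intro f
    have := congrArg (fun s => (Multiset.map f s).sum) hms
    simp only [Multiset.map_map] at this
    exact this
  -- the two eigenprojections
  set E := (1/2 : ℝ) • (1 + F) with hEdef
  have h1E : 1 - E = (1/2 : ℝ) • (1 - F) := by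
    rw [hEdef]; module
  have hFE : F = E - (1 - E) := by rw [h1E, hEdef]; module
  have hEE : E * E = E := by
    rw [hEdef, smul_mul_smul_comm, mul_add, add_mul, add_mul, hFF]
    simp only [mul_one, one_mul]; module
  have hGG : (1 - E) * (1 - E) = 1 - E := by
    simp [mul_sub, sub_mul, hEE]
  have hEh : E.IsHermitian := by
    rw [hEdef, IsHermitian, conjTranspose_smul, conjTranspose_add, hFh.eq]; simp
  have hGh : (1 - E).IsHermitian := isHermitian_one.sub hEh
  have cE : ∀ {Y : Matrix (Fin (m + m)) (Fin (m + m)) ℝ}, Commute F Y → Commute E Y :=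
    fun h => ((Commute.one_left _).add_left h).smul_left _
  have cG : ∀ {Y : Matrix (Fin (m + m)) (Fin (m + m)) ℝ}, Commute F Y → Commute (1 - E) Y :=
    fun h => (Commute.one_left _).sub_left (cE h)
  have hPE : E * P = P * (1 - E) := by
    rw [h1E, hEdef, smul_mul_assoc, mul_smul_comm, add_mul, mul_sub, hFP, one_mul, mul_one,
      sub_eq_add_neg]
  have hPG : (1 - E) * P = P * (1 - (1 - E)) := by
    rw [sub_mul, hPE]; simp [mul_sub]
  have cFK : Commute F K := by
    have hPF : P * F = -(F * P) := by rw [hFP, neg_neg]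
    have cPWP : Commute F (P * W * P) := by
      change F * (P * W * P) = P * W * P * F
      calc F * (P * W * P) = (F * P) * W * P := by simp only [mul_assoc]
        _ = -(P * (F * W) * P) := by rw [hFP]; simp only [mul_assoc, neg_mul]
        _ = P * W * -(F * P) := by rw [cFW.eq]; simp only [mul_assoc, mul_neg]
        _ = _ := by rw [← hPF]; simp only [mul_assoc]
    have : K = R' * (P * W * P) * R' := by rw [hKdef]; simp only [mul_assoc]
    rw [this]
    exact (cFR'.mul_right cPWP).mul_right cFR'
  obtain ⟨a1, a2⟩ := aux_dl_rel E V P W W' R' hEE hPP hPE hW'W hWW hR'R' (cE cFW) (cE cFR')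
  obtain ⟨b1, b2⟩ := aux_dl_rel (1 - E) V P W W' R' hGG hPP hPG hW'W hWW hR'R' (cG cFW) (cG cFR')
  rw [sub_sub_cancel] at b1
  have htr : ∀ Y : Matrix (Fin (m + m)) (Fin (m + m)) ℝ,
      (F * Y).trace = (E * Y).trace - ((1 - E) * Y).trace := by
    intro Y
    rw [← trace_sub, ← sub_mul, ← hFE]
  have inj : ∀ x y : ℝ, (2 : ℝ) ^ x = 2 ^ y → x = y := fun x y h =>
    (Real.strictMono_rpow_of_base_gt_one (by norm_num : (1 : ℝ) < 2)).injective h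
  have htrV : (F * mlogb2 V).trace = -(F * mlogb2 K).trace := by
    rw [htr, htr]
    simp only [mlogb2]
    rw [← hKdef, aux_key E K hEE hEh (cE cFK) hKpd, aux_key E W hEE hEh (cE cFW) hWpd,
      aux_key (1 - E) W hGG hGh (cG cFW) hWpd, ← Real.rpow_add (by norm_num)] at a1
    rw [← hKdef, aux_key (1 - E) K hGG hGh (cG cFK) hKpd, aux_key E W hEE hEh (cE cFW) hWpd,
      aux_key (1 - E) W hGG hGh (cG cFW) hWpd, ← Real.rpow_add (by norm_num)] at b1
    rw [aux_key E V hEE hEh (cE hFV) hVpd, aux_key E W hEE hEh (cE cFW) hWpd,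
      ← Real.rpow_add (by norm_num)] at a2
    rw [aux_key (1 - E) V hGG hGh (cG hFV) hVpd, aux_key (1 - E) W hGG hGh (cG cFW) hWpd,
      ← Real.rpow_add (by norm_num)] at b2
    have a1 := inj _ _ a1
    have a2 := inj _ _ a2
    have b1 := inj _ _ b1
    have b2 := inj _ _ b2
    linarith
  have hbound : |(F * mlogb2 V).trace| ≤ ∑ i, |Real.logb 2 (μ i)| := by
    rw [htrV, abs_neg]
    exact aux_trace_le F K (aux_flip_unitary _) hKpd.1 _
  -- determinant one
  have hμpos : ∀ i, 0 < μ i := hKpd.eigenvalues_pos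
  have hdet : K.det = 1 := by
    have e1 : W'.det * W.det = 1 := by rw [← det_mul, hW'W, det_one]
    have e2 : P.det * P.det = 1 := by rw [← det_mul, hPP, det_one]
    have e3 : R'.det * R'.det = W'.det := by rw [← det_mul, hR'R']
    rw [hKdef]
    simp only [det_mul]
    linear_combination W.det * P.det * P.det * e3 + P.det * P.det * e1 + e2
  have hlog0 : ∑ i, Real.logb 2 (μ i) = 0 := by
    rw [hKpd.1.det_eq_prod_eigenvalues] at hdet
    rw [← Real.logb_prod _ _ (fun i _ => (hμpos i).ne')]
    have : ∏ i, μ i = 1 := by simpa using hdet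
    rw [this, Real.logb_one]
  have hpt : ∀ i, -Real.logb 2 (min 1 (μ i)) =
      (|Real.logb 2 (μ i)| - Real.logb 2 (μ i)) / 2 := by
    intro i
    rcases le_total 1 (μ i) with h | h
    · rw [min_eq_left h, Real.logb_one, abs_of_nonneg (Real.logb_nonneg (by norm_num) h)]; ring
    · rw [min_eq_right h, abs_of_nonpos (Real.logb_nonpos (by norm_num) (hμpos i).le h)]; ring
  have hNeq : N = (∑ i, |Real.logb 2 (μ i)|) / 2 := by
    rw [hN, hsum (fun x => Real.logb 2 (min 1 x)), ← Finset.sum_neg_distrib,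
      Finset.sum_congr rfl (fun i _ => hpt i), ← Finset.sum_div, Finset.sum_sub_distrib, hlog0,
      sub_zero]
  rw [hNeq, ge_iff_le]
  linarith
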